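/- Assume b is bounded and set M = sup |b|. Then for any p ≥ d, μ > 0, and u ∈ Ŵ²_d(Q) ∩ C(Q̄) with u ≤ 0 on ∂Q and limsup_{|x|→∞, x∈Q} u ≤ 0 if Q is unbounded: μ ‖u₊‖_{L_p(Q)} ≤ N (K+1) ‖(μu − Lu)₊‖_{L_p(Q)} if μ ≥ (K+1)M², and μ² ‖u₊‖_{L_p(Q)} ≤ N (K+1)² M² ‖(μu − Lu)₊‖_{L_p(Q)} if μ ≤ (K+1)M², where N = N(d,δ,p). -/

import Mathlib

open MeasureTheory ENNReal Set

noncomputable section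

/-- The Frobenius norm of a matrix, used as `|D²u|`. -/
def frobNorm {d : ℕ} (m : Matrix (Fin d) (Fin d) ℝ) : ℝ :=
  Real.sqrt (∑ i, ∑ j, (m i j) ^ 2)

open Filter Topology in
lemma abp_accum {E : Type*} [NormedAddCommGroup E] [NormedSpace ℝ E] [MeasurableSpace E]
    [BorelSpace E] [FiniteDimensional ℝ E] (μ : Measure E) [μ.IsAddHaarMeasure]
    {s : Set E} (hs : IsCompact s) (v : E) :
    ∀ᵐ y ∂μ, y ∈ s → ∃ t : ℕ → ℝ, (∀ n, t n ≠ 0) ∧ Tendsto t atTop (𝓝 0) ∧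
      ∀ n, y + t n • v ∈ s := by
  let T : ℕ → ℕ → Set ℝ := fun n m =>
    {τ : ℝ | 1 / ((m : ℝ) + 1) ≤ |τ|} ∩ Metric.closedBall 0 (1 / ((n : ℝ) + 1))
  have hT : ∀ n m, IsCompact (T n m) := fun n m =>
    (isCompact_closedBall _ _).inter_left (isClosed_le continuous_const continuous_abs)
  let P : ℕ → ℕ → Set E := fun n m => (fun q : E × ℝ => q.1 - q.2 • v) '' (s ×ˢ T n m)
  have hP : ∀ n m, IsCompact (P n m) := fun n m =>
    (hs.prod (hT n m)).image (by fun_prop)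
  let B : ℕ → Set E := fun n => s \ ⋃ m, P n m
  have hBm : ∀ n, MeasurableSet (B n) := fun n =>
    hs.measurableSet.diff (MeasurableSet.iUnion fun m => (hP n m).measurableSet)
  have hB0 : ∀ n, μ (B n) = 0 := by
    intro n
    have hτ : ∀ k : ℕ, 0 < 1 / (((n : ℝ) + 1) * ((k : ℝ) + 1)) ∧
        1 / (((n : ℝ) + 1) * ((k : ℝ) + 1)) ≤ 1 / ((n : ℝ) + 1) := by
      intro k
      refine ⟨by positivity, ?_⟩
      apply one_div_le_one_div_of_le (by positivity)
      have : (0 : ℝ) ≤ k := by positivity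
      have : (0 : ℝ) ≤ n := by positivity
      nlinarith
    refine Measure.addHaar_eq_zero_of_disjoint_translates μ
      (fun k : ℕ => (1 / (((n : ℝ) + 1) * ((k : ℝ) + 1))) • v) ?_ ?_ (hBm n)
    · refine (Metric.isBounded_closedBall (x := (0 : E)) (r := (1 / ((n : ℝ) + 1)) * ‖v‖)).subset ?_
      rintro _ ⟨k, rfl⟩
      rw [mem_closedBall_zero_iff, norm_smul, Real.norm_of_nonneg (hτ k).1.le]
      exact mul_le_mul_of_nonneg_right (hτ k).2 (norm_nonneg _)
    · intro k l hkl
      rw [Function.onFun, Set.disjoint_left]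
      intro z hz hz'
      rw [Set.singleton_add] at hz hz'
      obtain ⟨y, hy, rfl⟩ := hz
      obtain ⟨y', hy', he⟩ := hz'
      simp only at he
      apply hy.2
      set tk := 1 / (((n : ℝ) + 1) * ((k : ℝ) + 1)) with htk
      set tl := 1 / (((n : ℝ) + 1) * ((l : ℝ) + 1)) with htl
      have hne : tk - tl ≠ 0 := by
        intro h0
        have h1 : tk = tl := by linarith
        rw [htk, htl] at h1
        have h2 : ((n : ℝ) + 1) * ((k : ℝ) + 1) = ((n : ℝ) + 1) * ((l : ℝ) + 1) := by
          have := congrArg (fun x : ℝ => x⁻¹) h1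
          simpa only [one_div, inv_inv] using this
        have h3 : (k : ℝ) + 1 = (l : ℝ) + 1 := mul_left_cancel₀ (by positivity) h2
        exact hkl (by exact_mod_cast (by linarith : (k : ℝ) = l))
      obtain ⟨m, hm⟩ := exists_nat_one_div_lt (abs_pos.2 hne)
      refine mem_iUnion.2 ⟨m, (y', tk - tl), ⟨hy'.1, hm.le, ?_⟩, ?_⟩
      · rw [mem_closedBall_zero_iff, Real.norm_eq_abs, abs_le]
        have := hτ k
        have := hτ l
        constructor <;> linarith
      · simp only
        rw [sub_smul]
        have : y' = tk • v + y - tl • v := by rw [← he]; abel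
        rw [this]; abel
  have hall : ∀ᵐ y ∂μ, ∀ n, y ∉ B n := by
    rw [ae_all_iff]; intro n
    exact measure_eq_zero_iff_ae_notMem.1 (hB0 n)
  filter_upwards [hall] with y hy hys
  have : ∀ n : ℕ, ∃ τ : ℝ, τ ≠ 0 ∧ |τ| ≤ 1 / ((n : ℝ) + 1) ∧ y + τ • v ∈ s := by
    intro n
    have h1 : y ∈ ⋃ m, P n m := by
      by_contra h
      exact hy n ⟨hys, h⟩
    obtain ⟨m, ⟨x, τ⟩, ⟨hx, h2, h3⟩, h4⟩ := mem_iUnion.1 h1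
    refine ⟨τ, ?_, by simpa [Real.norm_eq_abs] using h3, ?_⟩
    · have h2' : 1 / ((m : ℝ) + 1) ≤ |τ| := h2
      have : 0 < 1 / ((m : ℝ) + 1) := by positivity
      exact abs_pos.1 (by linarith)
    · simp only at h4 hx
      rw [← h4]; simpa using hx
  choose t h1 h2 h3 using this
  refine ⟨t, h1, ?_, h3⟩
  exact squeeze_zero_norm h2 tendsto_one_div_add_atTop_nhds_zero_nat

open Filter Topology in
lemma abp_piece {d : ℕ} {s : Set (EuclideanSpace ℝ (Fin d))} (hs : IsCompact s)
    (G : EuclideanSpace ℝ (Fin d) → EuclideanSpace ℝ (Fin d))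
    (D : EuclideanSpace ℝ (Fin d) → Matrix (Fin d) (Fin d) ℝ) {C : NNReal}
    (hG : LipschitzOnWith C G s)
    (hD : ∀ y ∈ s, ∀ i j,
      HasDerivAt (fun t : ℝ => G (y + t • EuclideanSpace.single j (1 : ℝ)) i) (D y i j) 0)
    (hm : ∀ x ∈ s, ∀ y ∈ s, inner ℝ (G x - G y) (x - y) ≤ 0) :
    ∀ᵐ y, y ∈ s → HasFDerivWithinAt G (Matrix.toEuclideanCLM (𝕜 := ℝ) (D y)) s y ∧
      ∀ v, inner ℝ (Matrix.toEuclideanCLM (𝕜 := ℝ) (D y) v) v ≤ 0 := by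
  have h1 : ∀ᵐ y, ∀ j : Fin d, y ∈ s → ∃ t : ℕ → ℝ, (∀ n, t n ≠ 0) ∧ Tendsto t atTop (𝓝 0) ∧
      ∀ n, y + t n • EuclideanSpace.single j (1 : ℝ) ∈ s := by
    rw [ae_all_iff]; intro j; exact abp_accum volume hs _
  have h2 : ∀ᵐ y, ∀ k : ℕ, y ∈ s → ∃ t : ℕ → ℝ, (∀ n, t n ≠ 0) ∧ Tendsto t atTop (𝓝 0) ∧
      ∀ n, y + t n • TopologicalSpace.denseSeq (EuclideanSpace ℝ (Fin d)) k ∈ s := by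
    rw [ae_all_iff]; intro j; exact abp_accum volume hs _
  filter_upwards [h1, h2, hG.ae_differentiableWithinAt_of_mem (μ := volume)] with y h1 h2 h3 hy
  obtain ⟨F, hF⟩ := h3 hy
  have key : ∀ v, (∃ t : ℕ → ℝ, (∀ n, t n ≠ 0) ∧ Tendsto t atTop (𝓝 0) ∧
      ∀ n, y + t n • v ∈ s) → ∃ t : ℕ → ℝ, (∀ n, t n ≠ 0) ∧ Tendsto t atTop (𝓝 0) ∧
      (∀ n, y + t n • v ∈ s) ∧
      Tendsto (fun n => (t n)⁻¹ • (G (y + t n • v) - G y)) atTop (𝓝 (F v)) := by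
    rintro v ⟨t, ht0, ht, hts⟩
    refine ⟨t, ht0, ht, hts, ?_⟩
    apply hF.lim (c := fun n => (t n)⁻¹) (d := fun n => t n • v)
    · simpa using ht.smul_const v
    · exact Eventually.of_forall hts
    · simp only [smul_smul]
      have : ∀ n, (t n)⁻¹ * t n = 1 := fun n => inv_mul_cancel₀ (ht0 n)
      simp [this]
  have hFD : F = Matrix.toEuclideanCLM (𝕜 := ℝ) (D y) := by
    have : (F : EuclideanSpace ℝ (Fin d) →ₗ[ℝ] EuclideanSpace ℝ (Fin d)) =
        (Matrix.toEuclideanCLM (𝕜 := ℝ) (D y) :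
          EuclideanSpace ℝ (Fin d) →L[ℝ] EuclideanSpace ℝ (Fin d)) := by
      apply (EuclideanSpace.basisFun (Fin d) ℝ).toBasis.ext
      intro j
      obtain ⟨t, ht0, ht, hts, hlim⟩ := key _ (h1 j hy)
      ext i
      have hA : Tendsto (fun n => ((t n)⁻¹ • (G (y + t n • EuclideanSpace.single j (1 : ℝ)) - G y)) i)
          atTop (𝓝 (F (EuclideanSpace.single j 1) i)) :=
        ((EuclideanSpace.proj (𝕜 := ℝ) i).continuous.tendsto _).comp hlim
      have hB := (hasDerivAt_iff_tendsto_slope_zero.1 (hD y hy i j)).comp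
        (tendsto_nhdsWithin_iff.2 ⟨ht, Eventually.of_forall ht0⟩)
      have hAB := tendsto_nhds_unique hA (by simpa [Function.comp_def] using hB)
      simp [hAB, Matrix.mulVec_single]
    exact ContinuousLinearMap.coe_injective this
  rw [← hFD]
  refine ⟨hF, ?_⟩
  have hcl : IsClosed {v | inner ℝ (F v) v ≤ 0} :=
    isClosed_le (F.continuous.inner continuous_id) continuous_const
  have hd : Dense {v | inner ℝ (F v) v ≤ 0} := by
    refine (TopologicalSpace.denseRange_denseSeq (EuclideanSpace ℝ (Fin d))).mono ?_
    rintro _ ⟨k, rfl⟩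
    obtain ⟨t, ht0, ht, hts, hlim⟩ := key _ (h2 k hy)
    set v := TopologicalSpace.denseSeq (EuclideanSpace ℝ (Fin d)) k
    refine le_of_tendsto (Filter.Tendsto.inner (𝕜 := ℝ) hlim tendsto_const_nhds) (Eventually.of_forall fun n => ?_)
    have := hm _ (hts n) _ hy
    rw [add_sub_cancel_left, inner_smul_right] at this
    rw [real_inner_smul_left]
    have h5 : (t n)⁻¹ = (t n)⁻¹ * (t n)⁻¹ * t n := by
      field_simp [ht0 n]
    rw [h5, mul_assoc]
    exact mul_nonpos_of_nonneg_of_nonpos (mul_self_nonneg _) this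
  intro v
  have : v ∈ closure {v | inner ℝ (F v) v ≤ 0} := hd v
  rwa [hcl.closure_eq] at this

lemma abp_null {d : ℕ} {s : Set (EuclideanSpace ℝ (Fin d))} {C : NNReal}
    {G : EuclideanSpace ℝ (Fin d) → EuclideanSpace ℝ (Fin d)}
    (hG : LipschitzOnWith C G s) (hs : volume s = 0) : volume (G '' s) = 0 := by
  have h1 := Measure.absolutelyContinuous_isAddHaarMeasure
    (volume : Measure (EuclideanSpace ℝ (Fin d)))
    (μH[Module.finrank ℝ (EuclideanSpace ℝ (Fin d))])
  have h2 := Measure.absolutelyContinuous_isAddHaarMeasure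
    (μH[Module.finrank ℝ (EuclideanSpace ℝ (Fin d))])
    (volume : Measure (EuclideanSpace ℝ (Fin d)))
  apply h1
  have h3 := hG.hausdorffMeasure_image_le
    (d := Module.finrank ℝ (EuclideanSpace ℝ (Fin d))) (by positivity)
  rw [h2 hs, mul_zero] at h3
  exact le_antisymm h3 (zero_le)

lemma abp_det {d : ℕ} (M : Matrix (Fin d) (Fin d) ℝ) :
    (Matrix.toEuclideanCLM (𝕜 := ℝ) M : EuclideanSpace ℝ (Fin d) →L[ℝ] _).det = M.det := by
  rw [ContinuousLinearMap.det, Matrix.coe_toEuclideanCLM_eq_toEuclideanLin,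
    Matrix.toEuclideanLin_eq_toLin_orthonormal, LinearMap.det_toLin]

open Filter Topology in
lemma abp_area {d : ℕ} {A : Set (EuclideanSpace ℝ (Fin d))} (hA : IsCompact A)
    (G : EuclideanSpace ℝ (Fin d) → EuclideanSpace ℝ (Fin d))
    (D : EuclideanSpace ℝ (Fin d) → Matrix (Fin d) (Fin d) ℝ)
    (hL : ∀ y ∈ A, ∃ C η : ℝ, 0 < η ∧ ∀ x ∈ A, dist x y < η → dist (G x) (G y) ≤ C * dist x y)
    (hD : ∀ y ∈ A, ∀ i j,
      HasDerivAt (fun t : ℝ => G (y + t • EuclideanSpace.single j (1 : ℝ)) i) (D y i j) 0)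
    (hm : ∀ x ∈ A, ∀ y ∈ A, inner ℝ (G x - G y) (x - y) ≤ 0) :
    volume (G '' A) ≤ ∫⁻ y in A, ENNReal.ofReal |(D y).det| ∧
    ∀ᵐ y, y ∈ A → ∀ v, inner ℝ (Matrix.toEuclideanCLM (𝕜 := ℝ) (D y) v) v ≤ 0 := by
  have hGc : ContinuousOn G A := by
    intro y hy
    obtain ⟨C, η, hη, h⟩ := hL y hy
    rw [ContinuousWithinAt, tendsto_iff_dist_tendsto_zero]
    have h0 : Tendsto (fun x => C * dist x y) (𝓝[A] y) (𝓝 0) := by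
      have : Tendsto (fun x => C * dist x y) (𝓝 y) (𝓝 (C * dist y y)) :=
        (Continuous.tendsto (by fun_prop) y)
      simp only [dist_self, mul_zero] at this
      exact this.mono_left nhdsWithin_le_nhds
    refine squeeze_zero' (Eventually.of_forall fun _ => dist_nonneg) ?_ h0
    filter_upwards [self_mem_nhdsWithin, mem_nhdsWithin_of_mem_nhds (Metric.ball_mem_nhds y hη)]
      with x hx hx'
    exact h x hx hx'
  let An : ℕ → Set (EuclideanSpace ℝ (Fin d)) := fun n =>
    {y ∈ A | ∀ x ∈ A, dist x y < 1 / ((n : ℝ) + 1) → dist (G x) (G y) ≤ n * dist x y}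
  have hAn : ∀ n, IsCompact (An n) := by
    intro n
    refine hA.of_isClosed_subset ?_ (fun y hy => hy.1)
    apply isClosed_of_closure_subset
    intro y hy
    obtain ⟨z, hz, hzy⟩ := mem_closure_iff_seq_limit.1 hy
    have hyA : y ∈ A := hA.isClosed.mem_of_tendsto hzy (Eventually.of_forall fun k => (hz k).1)
    refine ⟨hyA, fun x hx hxy => ?_⟩
    have hGz : Tendsto (fun k => G (z k)) atTop (𝓝 (G y)) :=
      (hGc y hyA).tendsto.comp (tendsto_nhdsWithin_iff.2
        ⟨hzy, Eventually.of_forall fun k => (hz k).1⟩)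
    have hdz : Tendsto (fun k => dist x (z k)) atTop (𝓝 (dist x y)) := tendsto_const_nhds.dist hzy
    refine le_of_tendsto_of_tendsto (tendsto_const_nhds.dist hGz) (hdz.const_mul (n : ℝ)) ?_
    filter_upwards [hdz.eventually_lt_const hxy] with k hk
    exact (hz k).2 x hx hk
  let e : ℕ ≃ ℕ × ℕ := (Denumerable.eqv (ℕ × ℕ)).symm
  let S : ℕ → Set (EuclideanSpace ℝ (Fin d)) := fun k =>
    An (e k).1 ∩ Metric.closedBall (TopologicalSpace.denseSeq (EuclideanSpace ℝ (Fin d)) (e k).2)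
      (1 / (3 * (((e k).1 : ℝ) + 1)))
  have hS : ∀ k, IsCompact (S k) := fun k => (hAn _).inter_right Metric.isClosed_closedBall
  have hSA : ∀ k, S k ⊆ A := fun k y hy => hy.1.1
  have hSL : ∀ k, LipschitzOnWith ((e k).1 : NNReal) G (S k) := by
    intro k
    apply LipschitzOnWith.of_dist_le_mul
    intro x hx y hy
    have := hy.1.2 x hx.1.1
    simp only [NNReal.coe_natCast]
    apply this
    have h1 := Metric.mem_closedBall.1 hx.2
    have h2 := Metric.mem_closedBall.1 hy.2
    have h3 := dist_triangle_right x y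
      (TopologicalSpace.denseSeq (EuclideanSpace ℝ (Fin d)) (e k).2)
    have h4 : 1 / (3 * (((e k).1 : ℝ) + 1)) = (1 / (((e k).1 : ℝ) + 1)) / 3 := by
      field_simp
    have h5 : 0 < 1 / (((e k).1 : ℝ) + 1) := by positivity
    linarith
  have hcov : A ⊆ ⋃ k, S k := by
    intro y hy
    obtain ⟨C, η, hη, h⟩ := hL y hy
    obtain ⟨n1, hn1⟩ := exists_nat_ge C
    obtain ⟨n2, hn2⟩ := exists_nat_one_div_lt hη
    set n := max n1 n2
    have hyn : y ∈ An n := by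
      refine ⟨hy, fun x hx hxy => ?_⟩
      have h1 : dist x y < η := by
        refine hxy.trans_le (le_trans ?_ hn2.le)
        apply one_div_le_one_div_of_le (by positivity)
        have : (n2 : ℝ) ≤ n := by exact_mod_cast le_max_right _ _
        linarith
      refine (h x hx h1).trans (mul_le_mul_of_nonneg_right (hn1.trans ?_) dist_nonneg)
      exact_mod_cast le_max_left _ _
    obtain ⟨m, hm⟩ := Metric.denseRange_iff.1
      (TopologicalSpace.denseRange_denseSeq (EuclideanSpace ℝ (Fin d))) y
      (1 / (3 * ((n : ℝ) + 1))) (by positivity)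
    refine mem_iUnion.2 ⟨e.symm (n, m), ?_⟩
    simp only [S, Equiv.apply_symm_apply]
    exact ⟨hyn, hm.le⟩
  have hae : ∀ᵐ y, ∀ k, y ∈ S k →
      HasFDerivWithinAt G (Matrix.toEuclideanCLM (𝕜 := ℝ) (D y)) (S k) y ∧
      ∀ v, inner ℝ (Matrix.toEuclideanCLM (𝕜 := ℝ) (D y) v) v ≤ 0 := by
    rw [ae_all_iff]; intro k
    exact abp_piece (hS k) G D (hSL k) (fun y hy => hD y (hSA k hy))
      (fun x hx y hy => hm x (hSA k hx) y (hSA k hy))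
  refine ⟨?_, ?_⟩
  swap
  · filter_upwards [hae] with y hy hyA
    obtain ⟨k, hk⟩ := mem_iUnion.1 (hcov hyA)
    exact (hy k hk).2
  set N := toMeasurable volume {y | ¬ ∀ k, y ∈ S k →
      HasFDerivWithinAt G (Matrix.toEuclideanCLM (𝕜 := ℝ) (D y)) (S k) y ∧
      ∀ v, inner ℝ (Matrix.toEuclideanCLM (𝕜 := ℝ) (D y) v) v ≤ 0} with hNdef
  have hN0 : volume N = 0 := by rw [hNdef, measure_toMeasurable]; exact ae_iff.1 hae
  have hNm : MeasurableSet N := measurableSet_toMeasurable _ _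
  have hN : ∀ y ∉ N, ∀ k, y ∈ S k →
      HasFDerivWithinAt G (Matrix.toEuclideanCLM (𝕜 := ℝ) (D y)) (S k) y := by
    intro y hy k hk
    by_contra h
    exact hy (subset_toMeasurable _ _ (fun h' => h (h' k hk).1))
  let t : ℕ → Set (EuclideanSpace ℝ (Fin d)) := fun k => disjointed S k \ N
  have htS : ∀ k, t k ⊆ S k := fun k y hy => disjointed_subset S k hy.1
  have htm : ∀ k, MeasurableSet (t k) := fun k =>
    (MeasurableSet.disjointed (fun k => (hS k).measurableSet) k).diff hNm
  have htd : Pairwise (Function.onFun Disjoint t) := fun i j hij =>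
    (disjoint_disjointed S hij).mono sdiff_subset sdiff_subset
  have himg : G '' A ⊆ (⋃ k, G '' t k) ∪ ⋃ k, G '' (S k ∩ N) := by
    rintro _ ⟨y, hy, rfl⟩
    by_cases hyN : y ∈ N
    · obtain ⟨k, hk⟩ := mem_iUnion.1 (hcov hy)
      exact Or.inr (mem_iUnion.2 ⟨k, mem_image_of_mem _ ⟨hk, hyN⟩⟩)
    · have h1 := hcov hy
      rw [← iUnion_disjointed] at h1
      obtain ⟨k, hk⟩ := mem_iUnion.1 h1
      exact Or.inl (mem_iUnion.2 ⟨k, mem_image_of_mem _ ⟨hk, hyN⟩⟩)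
  calc volume (G '' A) ≤ volume (⋃ k, G '' t k) + volume (⋃ k, G '' (S k ∩ N)) :=
        (measure_mono himg).trans (measure_union_le _ _)
    _ = volume (⋃ k, G '' t k) := by
        rw [measure_iUnion_null (s := fun k => G '' (S k ∩ N)), add_zero]
        intro k
        exact abp_null ((hSL k).mono inter_subset_left)
          (measure_mono_null inter_subset_right hN0)
    _ ≤ ∑' k, volume (G '' t k) := measure_iUnion_le _
    _ ≤ ∑' k, ∫⁻ y in t k, ENNReal.ofReal |(D y).det| := by
        refine ENNReal.tsum_le_tsum fun k => ?_
        have := addHaar_image_le_lintegral_abs_det_fderiv volume (htm k)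
          (f := G) (f' := fun y => Matrix.toEuclideanCLM (𝕜 := ℝ) (D y))
          (fun y hy => (hN y hy.2 k (htS k hy)).mono (htS k))
        simpa only [abp_det] using this
    _ = ∫⁻ y in ⋃ k, t k, ENNReal.ofReal |(D y).det| := (lintegral_iUnion htm htd _).symm
    _ ≤ ∫⁻ y in A, ENNReal.ofReal |(D y).det| :=
        lintegral_mono_set (iUnion_subset fun k => (htS k).trans (hSA k))

open Filter Topology in
lemma abp_peano {φ g : ℝ → ℝ} {c η₀ : ℝ} (hη₀ : 0 < η₀)
    (hφ : ∀ t, |t| < η₀ → HasDerivAt φ (g t) t) (hg : HasDerivAt g c 0) :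
    ∃ C η : ℝ, 0 < η ∧ 0 ≤ C ∧ ∀ t, |t| < η → |φ t - φ 0 - t * g 0| ≤ C * t ^ 2 := by
  have hO := hg.isBigO_sub
  obtain ⟨C, hC, hCb⟩ := hO.exists_pos
  rw [Asymptotics.IsBigOWith, Metric.eventually_nhds_iff] at hCb
  obtain ⟨ε, hε, hb⟩ := hCb
  refine ⟨C, min ε η₀, lt_min hε hη₀, hC.le, fun t ht => ?_⟩
  have h1 : |t| < ε := ht.trans_le (min_le_left _ _)
  have h2 : |t| < η₀ := ht.trans_le (min_le_right _ _)
  have key := (convex_closedBall (0 : ℝ) |t|).norm_image_sub_le_of_norm_hasDerivWithin_le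
    (f := fun s => φ s - s * g 0) (f' := fun s => g s - g 0) (C := C * |t|) (x := 0) (y := t)
    ?_ ?_ ?_ ?_
  · have e : φ t - φ 0 - t * g 0 = (φ t - t * g 0) - (φ 0 - 0 * g 0) := by ring
    rw [e]
    simp only [Real.norm_eq_abs] at key
    refine key.trans (le_of_eq ?_)
    rw [sub_zero, mul_assoc, ← sq, sq_abs]
  · intro s hs
    rw [mem_closedBall_zero_iff, Real.norm_eq_abs] at hs
    have h3 := (hφ s (hs.trans_lt h2)).sub ((hasDerivAt_id s).mul_const (g 0))
    simp only [id, one_mul] at h3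
    exact h3.hasDerivWithinAt
  · intro s hs
    rw [mem_closedBall_zero_iff, Real.norm_eq_abs] at hs
    have h3 := hb (y := s) (by rw [Real.dist_eq, sub_zero]; exact hs.trans_lt h1)
    rw [sub_zero, Real.norm_eq_abs s] at h3
    exact h3.trans (mul_le_mul_of_nonneg_left hs hC.le)
  · simp
  · simp

lemma abp_shift {d : ℕ} {f : EuclideanSpace ℝ (Fin d) → ℝ} {y v : EuclideanSpace ℝ (Fin d)}
    {t c : ℝ} (h : HasDerivAt (fun s : ℝ => f ((y + t • v) + s • v)) c 0) :
    HasDerivAt (fun s : ℝ => f (y + s • v)) c t := by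
  have h' : HasDerivAt (fun s : ℝ => f ((y + t • v) + s • v)) c (t - t) := by simpa using h
  have := h'.comp_sub_const t t
  refine this.congr_of_eventuallyEq (Filter.Eventually.of_forall fun s => ?_)
  simp only
  congr 1
  rw [sub_smul]; abel

lemma abp_lip {d : ℕ} {V A : Set (EuclideanSpace ℝ (Fin d))} (hV : IsOpen V) (hAV : A ⊆ V)
    {w : EuclideanSpace ℝ (Fin d) → ℝ}
    {G : EuclideanSpace ℝ (Fin d) → EuclideanSpace ℝ (Fin d)}
    {D : EuclideanSpace ℝ (Fin d) → Matrix (Fin d) (Fin d) ℝ}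
    (hw : ∀ y ∈ V, ∀ i,
      HasDerivAt (fun t : ℝ => w (y + t • EuclideanSpace.single i (1 : ℝ))) (G y i) 0)
    (hD : ∀ y ∈ V, ∀ i j,
      HasDerivAt (fun t : ℝ => G (y + t • EuclideanSpace.single j (1 : ℝ)) i) (D y i j) 0)
    (hc : ∀ y ∈ A, ∀ x ∈ V, w x ≤ w y + inner ℝ (G y) (x - y)) :
    ∀ y ∈ A, ∃ C η : ℝ, 0 < η ∧ ∀ x ∈ A, dist x y < η → dist (G x) (G y) ≤ C * dist x y := by
  intro y hy
  obtain ⟨ρ, hρ, hρV⟩ := Metric.isOpen_iff.1 hV y (hAV hy)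
  have hin : ∀ (i : Fin d) (t : ℝ), |t| < ρ → y + t • EuclideanSpace.single i (1 : ℝ) ∈ V := by
    intro i t ht
    apply hρV
    rw [Metric.mem_ball, dist_eq_norm, add_sub_cancel_left, norm_smul]
    simpa using ht
  have h1 : ∀ i : Fin d, ∃ C η : ℝ, 0 < η ∧ 0 ≤ C ∧ ∀ t, |t| < η →
      |w (y + t • EuclideanSpace.single i (1 : ℝ)) - w y - t * G y i| ≤ C * t ^ 2 := by
    intro i
    have := abp_peano (φ := fun t => w (y + t • EuclideanSpace.single i (1 : ℝ)))
      (g := fun t => G (y + t • EuclideanSpace.single i (1 : ℝ)) i) hρ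
      (fun t ht => abp_shift (hw _ (hin i t ht) i)) (hD y (hAV hy) i i)
    simpa using this
  choose C η hη hC hb using h1
  set C' := ∑ i, C i
  have hC' : 0 ≤ C' := Finset.sum_nonneg fun i _ => hC i
  have hη' : ∃ η' : ℝ, 0 < η' ∧ η' ≤ ρ ∧ ∀ i, η' ≤ η i := by
    have : ∃ ε : ℝ, 0 < ε ∧ ∀ i ∈ (Finset.univ : Finset (Fin d)), ε ≤ η i := by
      induction (Finset.univ : Finset (Fin d)) using Finset.induction_on with
      | empty => exact ⟨1, one_pos, by simp⟩
      | insert a s _ ih =>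
        obtain ⟨ε, hε, h⟩ := ih
        refine ⟨min ε (η a), lt_min hε (hη a), fun i hi => ?_⟩
        rcases Finset.mem_insert.1 hi with rfl | hi
        · exact min_le_right _ _
        · exact (min_le_left _ _).trans (h i hi)
    obtain ⟨ε, hε, h⟩ := this
    exact ⟨min ε ρ, lt_min hε hρ, min_le_right _ _, fun i =>
      (min_le_left _ _).trans (h i (Finset.mem_univ i))⟩
  obtain ⟨η', hη'0, hη'ρ, hη'i⟩ := hη'
  refine ⟨d * C' * ((d : ℝ) + 1) ^ 2, η' / ((d : ℝ) + 1), by positivity, fun x hx hxy => ?_⟩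
  rcases eq_or_ne x y with rfl | hne
  · simp
  have hz : 0 < dist x y := dist_pos.2 hne
  set z := dist x y with hzdef
  set T := ((d : ℝ) + 1) * z with hT
  have hT0 : 0 < T := by positivity
  have hTη : T < η' := by
    rw [lt_div_iff₀ (by positivity)] at hxy
    rw [hT]; linarith
  set m := dist (G x) (G y) with hm
  have h2 : ∀ i : Fin d, T * |G x i - G y i| ≤ m * z + C' * T ^ 2 := by
    intro i
    have hCi : C i ≤ C' := Finset.single_le_sum (f := C) (fun i _ => hC i) (Finset.mem_univ i)
    have hcs : |inner ℝ (G x - G y) (x - y)| ≤ m * z := by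
      rw [hm, hzdef, dist_eq_norm, dist_eq_norm]
      exact abs_real_inner_le_norm _ _
    have hyx := hc y hy x (hAV hx)
    have gen : ∀ t : ℝ, |t| = T → t * (G y i - G x i) ≤ m * z + C' * T ^ 2 := by
      intro t ht
      have e1 := hb i t (by rw [ht]; exact hTη.trans_le (hη'i i))
      have e2 := hc x hx _ (hin i t (by rw [ht]; exact hTη.trans_le hη'ρ))
      have e3 : y + t • EuclideanSpace.single i (1 : ℝ) - x =
          t • EuclideanSpace.single i (1 : ℝ) - (x - y) := by abel
      rw [e3, inner_sub_right, inner_smul_right] at e2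
      have e4 : inner ℝ (G x) (EuclideanSpace.single i (1 : ℝ)) = G x i := by
        simp [EuclideanSpace.inner_single_right]
      rw [e4] at e2
      rw [inner_sub_left] at hcs
      have e5 := (abs_le.1 e1).1
      have e6 := (abs_le.1 hcs).1
      have e7 : t ^ 2 = T ^ 2 := by rw [← ht, sq_abs]
      rw [e7] at e5
      have e8 : C i * T ^ 2 ≤ C' * T ^ 2 := mul_le_mul_of_nonneg_right hCi (sq_nonneg _)
      nlinarith
    rcases abs_cases (G x i - G y i) with ⟨h, _⟩ | ⟨h, _⟩
    · rw [h]
      have := gen (-T) (by rw [abs_neg, abs_of_pos hT0])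
      linarith
    · rw [h]
      have := gen T (abs_of_pos hT0)
      linarith
  have h3 : m ≤ ∑ i, |G x i - G y i| := by
    rw [hm, dist_eq_norm, EuclideanSpace.norm_eq]
    apply Real.sqrt_le_iff.2
    refine ⟨Finset.sum_nonneg fun i _ => abs_nonneg _, ?_⟩
    have := Finset.sum_sq_le_sq_sum_of_nonneg (s := Finset.univ)
      (f := fun i => |G x i - G y i|) (fun i _ => abs_nonneg _)
    simpa [sq_abs] using this
  have h4 : T * m ≤ d * (m * z + C' * T ^ 2) := by
    calc T * m ≤ T * ∑ i, |G x i - G y i| := mul_le_mul_of_nonneg_left h3 hT0.le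
      _ = ∑ i, T * |G x i - G y i| := Finset.mul_sum _ _ _
      _ ≤ ∑ _i : Fin d, (m * z + C' * T ^ 2) := Finset.sum_le_sum fun i _ => h2 i
      _ = d * (m * z + C' * T ^ 2) := by simp; ring
  have h5 : z * m ≤ z * (d * C' * ((d : ℝ) + 1) ^ 2 * z) := by
    rw [hT] at h4
    nlinarith
  exact le_of_mul_le_mul_left h5 hz

open scoped MatrixOrder Matrix.Norms.L2Operator in
lemma abp_matrix {d : ℕ} {δ : ℝ} (hδ : 0 < δ) (a D : Matrix (Fin d) (Fin d) ℝ)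
    (ha : ∀ ξ : EuclideanSpace ℝ (Fin d), δ * ‖ξ‖ ^ 2 ≤ ∑ i, ∑ j, a i j * ξ i * ξ j)
    (hs : ∀ i j, D i j = D j i)
    (hn : ∀ v, inner ℝ (Matrix.toEuclideanCLM (𝕜 := ℝ) D v) v ≤ 0) :
    0 ≤ -(∑ i, ∑ j, a i j * D i j) ∧
    |D.det| ≤ ((-(∑ i, ∑ j, a i j * D i j)) / δ) ^ d := by
  have hP : (-D).PosSemidef := by
    rw [Matrix.posSemidef_iff_dotProduct_mulVec]
    refine ⟨?_, fun x => ?_⟩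
    · ext i j
      simp [hs i j]
    · have h1 := hn (WithLp.toLp 2 x)
      rw [real_inner_comm, EuclideanSpace.inner_eq_star_dotProduct] at h1
      rw [Matrix.neg_mulVec, dotProduct_neg]
      simp only [Matrix.ofLp_toEuclideanCLM, star_trivial] at h1 ⊢
      rw [dotProduct_comm]
      linarith
  have hpos := hP.eigenvalues_nonneg
  have htr := hP.1.trace_eq_sum_eigenvalues
  have hdet := hP.1.det_eq_prod_eigenvalues
  simp only [RCLike.ofReal_real_eq_id, id] at htr hdet
  have h1 : |D.det| ≤ ((-D).trace) ^ d := by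
    have e : |D.det| = (-D).det := by
      rw [← abs_of_nonneg hP.det_nonneg, Matrix.det_neg, abs_mul]
      simp
    rw [e, hdet, htr]
    calc ∏ i, hP.1.eigenvalues i ≤ ∏ _i : Fin d, ∑ i, hP.1.eigenvalues i :=
          Finset.prod_le_prod (fun i _ => hpos i) fun i _ =>
            Finset.single_le_sum (f := hP.1.eigenvalues) (fun i _ => hpos i) (Finset.mem_univ i)
      _ = _ := by simp
  have htr0 : 0 ≤ (-D).trace := by rw [htr]; exact Finset.sum_nonneg fun i _ => hpos i
  obtain ⟨B, hB⟩ := CStarAlgebra.nonneg_iff_eq_star_mul_self.mp hP.nonneg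
  have hBe : ∀ i j, -D i j = ∑ k, B k i * B k j := by
    intro i j
    have := congrFun (congrFun hB i) j
    simpa [Matrix.mul_apply, Matrix.star_eq_conjTranspose] using this
  have h2 : δ * (-D).trace ≤ -(∑ i, ∑ j, a i j * D i j) := by
    have e1 : -(∑ i, ∑ j, a i j * D i j) = ∑ k, ∑ i, ∑ j, a i j * B k i * B k j := by
      symm
      rw [Finset.sum_comm, ← Finset.sum_neg_distrib]
      refine Finset.sum_congr rfl fun i _ => ?_
      rw [Finset.sum_comm, ← Finset.sum_neg_distrib]
      refine Finset.sum_congr rfl fun j _ => ?_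
      rw [← mul_neg, hBe i j, Finset.mul_sum]
      exact Finset.sum_congr rfl fun k _ => by ring
    have e2 : (-D).trace = ∑ k, ∑ i, (B k i) ^ 2 := by
      rw [Finset.sum_comm, Matrix.trace]
      refine Finset.sum_congr rfl fun i _ => ?_
      have := hBe i i
      simp only [Matrix.diag_apply, Matrix.neg_apply, this, sq]
    rw [e1, e2, Finset.mul_sum]
    refine Finset.sum_le_sum fun k _ => ?_
    have := ha (WithLp.toLp 2 (B k))
    rw [EuclideanSpace.norm_sq_eq] at this
    simpa [sq_abs] using this
  have h3 : (-D).trace ≤ (-(∑ i, ∑ j, a i j * D i j)) / δ := by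
    rw [le_div_iff₀ hδ]; linarith
  refine ⟨(mul_nonneg hδ.le htr0).trans h2, h1.trans (pow_le_pow_left₀ htr0 h3 d)⟩

open Filter Topology in
lemma abp_locInt {d : ℕ} {Q : Set (EuclideanSpace ℝ (Fin d))} (hQ : IsOpen Q)
    {g Φ : EuclideanSpace ℝ (Fin d) → ℝ} (hg : Measurable g) (hgΦ : ∀ x, |g x| ≤ 1 + Φ x)
    (hΦ : ∀ G : Set (EuclideanSpace ℝ (Fin d)), IsOpen G → Bornology.IsBounded G → G ⊆ Q →
      IntegrableOn Φ G volume) : LocallyIntegrableOn g Q volume := by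
  intro x hx
  obtain ⟨ρ, hρ, hρV⟩ := Metric.isOpen_iff.1 hQ x hx
  refine ⟨Metric.ball x ρ, mem_nhdsWithin_of_mem_nhds (Metric.ball_mem_nhds x hρ), ?_⟩
  have h1 := hΦ _ Metric.isOpen_ball Metric.isBounded_ball hρV
  have h2 : IntegrableOn (fun x => 1 + Φ x) (Metric.ball x ρ) volume :=
    (integrableOn_const (measure_ball_lt_top).ne).add h1
  exact h2.mono' hg.aestronglyMeasurable (Eventually.of_forall hgΦ)

lemma abp_integrable {d : ℕ} {Q : Set (EuclideanSpace ℝ (Fin d))}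
    {g φ : EuclideanSpace ℝ (Fin d) → ℝ} (hg : LocallyIntegrableOn g Q volume)
    (hφ : Continuous φ) (hc : HasCompactSupport φ) (hs : tsupport φ ⊆ Q) :
    Integrable (fun x => φ x * g x) volume := by
  have h1 : IntegrableOn g (tsupport φ) volume := hg.integrableOn_compact_subset hs hc
  have h2 := h1.continuousOn_mul hφ.continuousOn hc
  refine (integrableOn_iff_integrable_of_support_subset ?_).1 h2
  intro x hx
  apply subset_tsupport
  intro h0
  apply hx
  simp [h0]

lemma abp_parts {d : ℕ} {Q : Set (EuclideanSpace ℝ (Fin d))}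
    {g g' φ : EuclideanSpace ℝ (Fin d) → ℝ} (v : EuclideanSpace ℝ (Fin d))
    (hg : LocallyIntegrableOn g Q volume)
    (hg' : LocallyIntegrableOn g' Q volume)
    (hd : ∀ x ∈ Q, HasDerivAt (fun s : ℝ => g (x + s • v)) (g' x) 0)
    (hφ : ContDiff ℝ (⊤ : ℕ∞) φ) (hc : HasCompactSupport φ) (hs : tsupport φ ⊆ Q) :
    ∫ x, φ x * g' x = - ∫ x, fderiv ℝ φ x v * g x := by
  have hcd : Continuous fun x => fderiv ℝ φ x v :=
    (hφ.continuous_fderiv (by simp)).clm_apply continuous_const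
  have := integral_bilinear_hasLineDerivAt_right_eq_neg_left_of_integrable
    (μ := (volume : Measure (EuclideanSpace ℝ (Fin d))))
    (f := φ) (f' := fun x => fderiv ℝ φ x v) (g := g) (g' := g') (v := v)
    (B := ContinuousLinearMap.mul ℝ ℝ) ?_ ?_ ?_ ?_ ?_
  · simpa using this
  · simpa using abp_integrable hg hcd (hc.fderiv_apply (𝕜 := ℝ) v)
      ((tsupport_fderiv_apply_subset ℝ v).trans hs)
  · simpa using abp_integrable hg' hφ.continuous hc hs
  · simpa using abp_integrable hg hφ.continuous hc hs
  · intro x _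
    exact ((hφ.differentiable (by simp)) x).hasFDerivAt.hasLineDerivAt v
  · intro x hx
    exact hd x (hs hx)

lemma abp_symm {d : ℕ} {Q : Set (EuclideanSpace ℝ (Fin d))} (hQ : IsOpen Q)
    {u : EuclideanSpace ℝ (Fin d) → ℝ}
    {du : EuclideanSpace ℝ (Fin d) → EuclideanSpace ℝ (Fin d)}
    {d2u : EuclideanSpace ℝ (Fin d) → Matrix (Fin d) (Fin d) ℝ}
    (hu : LocallyIntegrableOn u Q volume)
    (hdu : ∀ i, LocallyIntegrableOn (fun x => du x i) Q volume)
    (hd2u : ∀ i j, LocallyIntegrableOn (fun x => d2u x i j) Q volume)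
    (h1 : ∀ x ∈ Q, ∀ i,
          HasDerivAt (fun s : ℝ => u (x + s • EuclideanSpace.single i (1 : ℝ))) (du x i) 0)
    (h2 : ∀ x ∈ Q, ∀ i j,
          HasDerivAt (fun s : ℝ => du (x + s • EuclideanSpace.single j (1 : ℝ)) i) (d2u x i j) 0) :
    ∀ᵐ x, x ∈ Q → ∀ i j, d2u x i j = d2u x j i := by
  have key : ∀ φ : EuclideanSpace ℝ (Fin d) → ℝ, ContDiff ℝ (⊤ : ℕ∞) φ → HasCompactSupport φ →
      tsupport φ ⊆ Q → ∀ i j, ∫ x, φ x * d2u x i j =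
        ∫ x, fderiv ℝ (fun y => fderiv ℝ φ y (EuclideanSpace.single j (1 : ℝ))) x
          (EuclideanSpace.single i (1 : ℝ)) * u x := by
    intro φ hφ hc hs i j
    rw [abp_parts _ (hdu i) (hd2u i j) (fun x hx => h2 x hx i j) hφ hc hs,
      abp_parts (φ := fun y => fderiv ℝ φ y (EuclideanSpace.single j (1 : ℝ))) _ hu (hdu i)
        (fun x hx => h1 x hx i) ?_ (hc.fderiv_apply (𝕜 := ℝ) _)
        ((tsupport_fderiv_apply_subset ℝ _).trans hs), neg_neg]
    exact (hφ.fderiv_right (m := (⊤ : ℕ∞)) (by simp)).clm_apply contDiff_const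
  have hall : ∀ᵐ x, ∀ i j, x ∈ Q → d2u x i j - d2u x j i = 0 := by
    rw [ae_all_iff]; intro i
    rw [ae_all_iff]; intro j
    refine hQ.ae_eq_zero_of_integral_contDiff_smul_eq_zero ((hd2u i j).sub (hd2u j i)) ?_
    intro φ hφ hc hs
    simp only [smul_eq_mul, mul_sub]
    rw [integral_sub (abp_integrable (hd2u i j) hφ.continuous hc hs)
      (abp_integrable (hd2u j i) hφ.continuous hc hs), key φ hφ hc hs, key φ hφ hc hs, sub_eq_zero]
    congr 1
    ext x
    congr 1
    have hd : DifferentiableAt ℝ (fderiv ℝ φ) x :=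
      ((hφ.fderiv_right (m := (⊤ : ℕ∞)) (by simp)).differentiable (by simp)) x
    have hf : ∀ v w : EuclideanSpace ℝ (Fin d),
        fderiv ℝ (fun y => fderiv ℝ φ y v) x w = fderiv ℝ (fderiv ℝ φ) x w v := by
      intro v w
      rw [fderiv_clm_apply hd (differentiableAt_const v)]
      simp
    rw [hf, hf]
    have := (hφ.contDiffAt (x := x)).isSymmSndFDerivAt
      (by simp; exact WithTop.coe_le_coe.2 (le_top : (2 : ℕ∞) ≤ ⊤))
    exact this _ _
  filter_upwards [hall] with x hx hxQ i j
  exact sub_eq_zero.1 (hx i j hxQ)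

open Filter Topology in
lemma abp_contact_compact {d : ℕ} {S : Set (EuclideanSpace ℝ (Fin d))} (hS : IsCompact S)
    {w : EuclideanSpace ℝ (Fin d) → ℝ} (hw : ContinuousOn w S) (ρ : ℝ) :
    IsCompact {y ∈ S | ∃ p : EuclideanSpace ℝ (Fin d), ‖p‖ ≤ ρ ∧
      ∀ x ∈ S, w x ≤ w y + inner ℝ p (x - y)} := by
  refine hS.of_isClosed_subset ?_ (fun y hy => hy.1)
  apply isClosed_of_closure_subset
  intro y hy
  obtain ⟨z, hz, hzy⟩ := mem_closure_iff_seq_limit.1 hy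
  have hyS : y ∈ S := hS.isClosed.mem_of_tendsto hzy (Eventually.of_forall fun k => (hz k).1)
  choose p hp hpc using fun k => (hz k).2
  obtain ⟨q, hq, φ, hφ, hlim⟩ := (isCompact_closedBall (0 : EuclideanSpace ℝ (Fin d)) ρ).tendsto_subseq
    (x := p) (fun k => by simpa using hp k)
  refine ⟨hyS, q, by simpa using hq, fun x hx => ?_⟩
  have h1 : Tendsto (fun k => z (φ k)) atTop (𝓝 y) := hzy.comp hφ.tendsto_atTop
  have h2 : Tendsto (fun k => w (z (φ k))) atTop (𝓝 (w y)) :=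
    (hw y hyS).tendsto.comp (tendsto_nhdsWithin_iff.2
      ⟨h1, Eventually.of_forall fun k => (hz _).1⟩)
  have h3 : Tendsto (fun k => inner ℝ (p (φ k)) (x - z (φ k))) atTop (𝓝 (inner ℝ q (x - y))) :=
    Filter.Tendsto.inner (𝕜 := ℝ) hlim (tendsto_const_nhds.sub h1)
  exact ge_of_tendsto (h2.add h3) (Eventually.of_forall fun k => hpc (φ k) x hx)

open Filter Topology in
lemma abp_core {d : ℕ} (hd : 1 ≤ d) {δ : ℝ} (hδ0 : 0 < δ) {K M μ r h : ℝ} (hr : 0 < r) (hμ : 0 < μ)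
    (hh : 0 < h) (hM : 0 ≤ M) (hK : K ≤ μ * r ^ 2) (hMr : M ≤ μ * r)
    (a : EuclideanSpace ℝ (Fin d) → Matrix (Fin d) (Fin d) ℝ)
    (b : EuclideanSpace ℝ (Fin d) → EuclideanSpace ℝ (Fin d))
    (c f : EuclideanSpace ℝ (Fin d) → ℝ)
    (ha : ∀ x (ξ : EuclideanSpace ℝ (Fin d)), δ * ‖ξ‖ ^ 2 ≤ ∑ i, ∑ j, a x i j * ξ i * ξ j)
    (htr : ∀ x, Matrix.trace (a x) ≤ K)
    (hb : ∀ x, ‖b x‖ ≤ M) (hc : ∀ x, 0 ≤ c x)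
    {Q : Set (EuclideanSpace ℝ (Fin d))} (hQ : IsOpen Q)
    (u : EuclideanSpace ℝ (Fin d) → ℝ)
    (du : EuclideanSpace ℝ (Fin d) → EuclideanSpace ℝ (Fin d))
    (d2u : EuclideanSpace ℝ (Fin d) → Matrix (Fin d) (Fin d) ℝ)
    (h1 : ∀ x ∈ Q, ∀ i,
          HasDerivAt (fun s : ℝ => u (x + s • EuclideanSpace.single i (1 : ℝ))) (du x i) 0)
    (h2 : ∀ x ∈ Q, ∀ i j,
          HasDerivAt (fun s : ℝ => du (x + s • EuclideanSpace.single j (1 : ℝ)) i) (d2u x i j) 0)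
    (hsym : ∀ᵐ x, x ∈ Q → ∀ i j, d2u x i j = d2u x j i)
    (hcont : ContinuousOn u (closure Q))
    (hbd : ∀ x ∈ frontier Q, u x ≤ 0)
    (hf : ∀ x, f x = μ * u x -
      ((∑ i, ∑ j, a x i j * d2u x i j) + (∑ i, b x i * du x i) - c x * u x))
    {x₁ : EuclideanSpace ℝ (Fin d)} (hx₁ : x₁ ∈ Q) (hux₁ : u x₁ = h)
    (hgr : ∀ x ∈ closure Q, u x ≤ h * (1 + ‖x - x₁‖ / (50 * r)) ^ 2) :
    ENNReal.ofReal ((h / (50 * r)) ^ d) *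
        volume (Metric.ball (0 : EuclideanSpace ℝ (Fin d)) 1) ≤
      ∫⁻ y in Q ∩ Metric.ball x₁ r, ENNReal.ofReal ((max (f y) 0 / δ) ^ d) := by
  set ρ := h / (50 * r) with hρ
  have hρ0 : 0 < ρ := by positivity
  have hρr : ρ * r = h / 50 := by rw [hρ]; field_simp
  set q := h / (5 * r ^ 2) with hq
  have hq0 : 0 < q := by positivity
  have hqr : q * r ^ 2 = h / 5 := by rw [hq]; field_simp
  set S := closure Q ∩ Metric.closedBall x₁ r with hSdef
  have hS : IsCompact S := (isCompact_closedBall x₁ r).inter_left isClosed_closure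
  set V := Q ∩ Metric.ball x₁ r with hVdef
  have hV : IsOpen V := hQ.inter Metric.isOpen_ball
  have hVS : V ⊆ S := inter_subset_inter subset_closure Metric.ball_subset_closedBall
  let w : EuclideanSpace ℝ (Fin d) → ℝ := fun x => u x - q / 2 * ‖x - x₁‖ ^ 2
  let G : EuclideanSpace ℝ (Fin d) → EuclideanSpace ℝ (Fin d) := fun x => du x - q • (x - x₁)
  let D : EuclideanSpace ℝ (Fin d) → Matrix (Fin d) (Fin d) ℝ := fun x => d2u x - q • 1
  have hw : ContinuousOn w S :=
    (hcont.mono inter_subset_left).sub (Continuous.continuousOn (by fun_prop))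
  have hwx₁ : w x₁ = h := by simp [w, hux₁]
  have hx₁V : x₁ ∈ V := ⟨hx₁, Metric.mem_ball_self hr⟩
  have hwG : ∀ y ∈ V, ∀ i,
      HasDerivAt (fun t : ℝ => w (y + t • EuclideanSpace.single i (1 : ℝ))) (G y i) 0 := by
    intro y hy i
    have e1 : HasDerivAt (fun t : ℝ => y + t • EuclideanSpace.single i (1 : ℝ) - x₁)
        (EuclideanSpace.single i (1 : ℝ)) 0 := by
      simpa using (((hasDerivAt_id (0 : ℝ)).smul_const
        (EuclideanSpace.single i (1 : ℝ))).const_add y).sub_const x₁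
    have e2 := (h1 y hy.1 i).sub ((e1.norm_sq).const_mul (q / 2))
    convert! e2 using 1
    simp [G, EuclideanSpace.inner_single_right]
    ring
  have hGD : ∀ y ∈ V, ∀ i j,
      HasDerivAt (fun t : ℝ => G (y + t • EuclideanSpace.single j (1 : ℝ)) i) (D y i j) 0 := by
    intro y hy i j
    have e1 : HasDerivAt (fun t : ℝ => q * ((y + t • EuclideanSpace.single j (1 : ℝ)) i - x₁ i))
        (q * (1 : Matrix (Fin d) (Fin d) ℝ) i j) 0 := by
      have e0 : HasDerivAt (fun t : ℝ => (y + t • EuclideanSpace.single j (1 : ℝ)) i - x₁ i)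
          ((1 : Matrix (Fin d) (Fin d) ℝ) i j) 0 := by
        have := (((hasDerivAt_id (0 : ℝ)).mul_const
          ((1 : Matrix (Fin d) (Fin d) ℝ) i j)).const_add (y i)).sub_const (x₁ i)
        convert! this using 1
        · ext t
          simp [Matrix.one_apply, Pi.single_apply]
        · simp
      exact e0.const_mul q
    have e2 := (h2 y hy.1 i j).sub e1
    convert! e2 using 1
  set A := {y ∈ S | ∃ p : EuclideanSpace ℝ (Fin d), ‖p‖ ≤ ρ ∧
      ∀ x ∈ S, w x ≤ w y + inner ℝ p (x - y)} with hAdef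
  have hA : IsCompact A := abp_contact_compact hS hw ρ
  -- basic information at contact points
  have hinfo : ∀ y ∈ S, ∀ p : EuclideanSpace ℝ (Fin d), ‖p‖ ≤ ρ →
      (∀ x ∈ S, w x ≤ w y + inner ℝ p (x - y)) → y ∈ V ∧ h * (1 - 1 / 50) ≤ u y ∧ G y = p := by
    intro y hy p hp hpc
    have hyr : ‖y - x₁‖ ≤ r := by
      have := hy.2; rwa [Metric.mem_closedBall, dist_eq_norm] at this
    have e1 := hpc x₁ (hVS hx₁V)
    have e2 : inner ℝ p (x₁ - y) ≤ h / 50 := by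
      calc inner ℝ p (x₁ - y) ≤ ‖p‖ * ‖x₁ - y‖ := real_inner_le_norm _ _
        _ ≤ ρ * r := by
          rw [norm_sub_rev]
          exact mul_le_mul hp hyr (norm_nonneg _) hρ0.le
        _ = h / 50 := hρr
    rw [hwx₁] at e1
    have e3 : w y = u y - q / 2 * ‖y - x₁‖ ^ 2 := rfl
    have e4 : 0 ≤ q / 2 * ‖y - x₁‖ ^ 2 := by positivity
    have huy : h * (1 - 1 / 50) ≤ u y := by linarith
    have hyQ : y ∈ Q := by
      by_contra hn
      have : y ∈ frontier Q := by
        rw [frontier, hQ.interior_eq]; exact ⟨hy.1, hn⟩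
      have := hbd y this
      linarith
    have hyB : y ∈ Metric.ball x₁ r := by
      rw [Metric.mem_ball, dist_eq_norm]
      refine lt_of_le_of_ne hyr fun he => ?_
      have e5 := hgr y hy.1
      rw [he] at e5 e3
      have e6 : r / (50 * r) = 1 / 50 := by field_simp
      rw [e6] at e5
      have e7 : q / 2 * r ^ 2 = h / 10 := by linarith
      rw [e7] at e3
      nlinarith
    have hyV : y ∈ V := ⟨hyQ, hyB⟩
    refine ⟨hyV, huy, ?_⟩
    ext i
    have e8 := (hwG y hyV i).sub ((hasDerivAt_id (0 : ℝ)).mul_const (p i))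
    have e9 : IsLocalMax ((fun t : ℝ => w (y + t • EuclideanSpace.single i (1 : ℝ))) -
        fun t => id t * p i) 0 := by
      have e10 : ∀ᶠ t : ℝ in 𝓝 0, y + t • EuclideanSpace.single i (1 : ℝ) ∈ V := by
        have : ContinuousAt (fun t : ℝ => y + t • EuclideanSpace.single i (1 : ℝ)) 0 := by fun_prop
        apply this.eventually_mem
        simpa using hV.mem_nhds hyV
      filter_upwards [e10] with t ht
      have := hpc _ (hVS ht)
      rw [add_sub_cancel_left, inner_smul_right] at this
      have e11 : inner ℝ p (EuclideanSpace.single i (1 : ℝ)) = p i := by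
        simp [EuclideanSpace.inner_single_right]
      rw [e11] at this
      simp only [Pi.sub_apply, id, zero_smul, add_zero, zero_mul, sub_zero]
      linarith
    have := e9.hasDerivAt_eq_zero e8
    linarith
  have hAV : A ⊆ V := by
    rintro y ⟨hy, p, hp, hpc⟩
    exact (hinfo y hy p hp hpc).1
  have hcA : ∀ y ∈ A, ∀ x ∈ V, w x ≤ w y + inner ℝ (G y) (x - y) := by
    rintro y ⟨hy, p, hp, hpc⟩ x hx
    rw [(hinfo y hy p hp hpc).2.2]
    exact hpc x (hVS hx)
  have hball : Metric.ball (0 : EuclideanSpace ℝ (Fin d)) ρ ⊆ G '' A := by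
    intro p hp
    have hp' : ‖p‖ ≤ ρ := by
      rw [mem_ball_zero_iff] at hp; exact hp.le
    obtain ⟨y, hy, hmax⟩ := hS.exists_isMaxOn ⟨x₁, hVS hx₁V⟩
      (f := fun x => w x - inner ℝ p x) (hw.sub (Continuous.continuousOn (by fun_prop)))
    have hpc : ∀ x ∈ S, w x ≤ w y + inner ℝ p (x - y) := by
      intro x hx
      have := hmax hx
      simp only [mem_setOf_eq] at this
      rw [inner_sub_right]; linarith
    exact ⟨y, ⟨hy, p, hp', hpc⟩, (hinfo y hy p hp' hpc).2.2⟩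
  have hmono : ∀ x ∈ A, ∀ y ∈ A, inner ℝ (G x - G y) (x - y) ≤ 0 := by
    intro x hx y hy
    have e1 := hcA x hx y (hAV hy)
    have e2 := hcA y hy x (hAV hx)
    rw [← neg_sub x y, inner_neg_right] at e1
    rw [inner_sub_left]
    linarith
  obtain ⟨harea, hneg⟩ := abp_area hA G D (abp_lip hV hAV hwG hGD hcA)
    (fun y hy => hGD y (hAV hy)) hmono
  have hnt : Nontrivial (EuclideanSpace ℝ (Fin d)) := by
    haveI : Nonempty (Fin d) := ⟨⟨0, hd⟩⟩
    infer_instance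
  calc ENNReal.ofReal (ρ ^ d) * volume (Metric.ball (0 : EuclideanSpace ℝ (Fin d)) 1)
      = volume (Metric.ball (0 : EuclideanSpace ℝ (Fin d)) ρ) := by
        rw [Measure.addHaar_ball volume 0 hρ0.le]; simp
    _ ≤ volume (G '' A) := measure_mono hball
    _ ≤ ∫⁻ y in A, ENNReal.ofReal |(D y).det| := harea
    _ ≤ ∫⁻ y in A, ENNReal.ofReal ((max (f y) 0 / δ) ^ d) := by
        apply setLIntegral_mono_ae' hA.measurableSet
        filter_upwards [hneg, hsym] with y hn hs hyA
        apply ENNReal.ofReal_le_ofReal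
        have hyV := hAV hyA
        obtain ⟨hP0, hPd⟩ := abp_matrix hδ0 (a y) (D y) (ha y) (fun i j => by
          have := hs hyV.1 i j
          simp [D, this, Matrix.one_apply, eq_comm]) (hn hyA)
        set P := -(∑ i, ∑ j, a y i j * D y i j) with hP
        refine hPd.trans (pow_le_pow_left₀ (div_nonneg hP0 hδ0.le) ?_ d)
        refine div_le_div_of_nonneg_right (le_max_of_le_left ?_) hδ0.le
        obtain ⟨hyS, p, hp, hpc⟩ := hyA
        obtain ⟨-, huy, hGp⟩ := hinfo y hyS p hp hpc
        have hyr : ‖y - x₁‖ ≤ r := by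
          have := hyS.2; rwa [Metric.mem_closedBall, dist_eq_norm] at this
        have eP : P = -(∑ i, ∑ j, a y i j * d2u y i j) + q * Matrix.trace (a y) := by
          have : ∑ i, ∑ j, a y i j * D y i j =
              (∑ i, ∑ j, a y i j * d2u y i j) - q * Matrix.trace (a y) := by
            rw [Matrix.trace, Finset.mul_sum, ← Finset.sum_sub_distrib]
            refine Finset.sum_congr rfl fun i _ => ?_
            simp [D, mul_sub, Finset.sum_sub_distrib, Matrix.one_apply, mul_comm]
          rw [hP, this]; ring
        have edu : ‖du y‖ ≤ 11 * ρ := by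
          have e1 : du y = p + q • (y - x₁) := by
            rw [← hGp]; simp [G]
          have e2 : q * r = 10 * ρ := by rw [hq, hρ]; field_simp; norm_num
          calc ‖du y‖ ≤ ‖p‖ + ‖q • (y - x₁)‖ := by rw [e1]; exact norm_add_le _ _
            _ ≤ ρ + q * r := by
              rw [norm_smul, Real.norm_of_nonneg hq0.le]
              exact add_le_add hp (mul_le_mul_of_nonneg_left hyr hq0.le)
            _ = 11 * ρ := by rw [e2]; ring
        have eb : ∑ i, b y i * du y i ≤ M * (11 * ρ) := by
          have : ∑ i, b y i * du y i = inner ℝ (b y) (du y) := by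
            simp [PiLp.inner_apply, mul_comm]
          rw [this]
          exact (real_inner_le_norm _ _).trans
            (mul_le_mul (hb y) edu (norm_nonneg _) hM)
        have eb2 : M * (11 * ρ) ≤ μ * (11 * h / 50) := by
          calc M * (11 * ρ) ≤ (μ * r) * (11 * ρ) :=
                mul_le_mul_of_nonneg_right hMr (by positivity)
            _ = μ * (11 * (ρ * r)) := by ring
            _ = μ * (11 * h / 50) := by rw [hρr]; ring
        have ek : q * Matrix.trace (a y) ≤ μ * (h / 5) := by
          calc q * Matrix.trace (a y) ≤ q * (μ * r ^ 2) :=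
                mul_le_mul_of_nonneg_left ((htr y).trans hK) hq0.le
            _ = μ * (q * r ^ 2) := by ring
            _ = μ * (h / 5) := by rw [hqr]
        have hu0 : 0 ≤ u y := le_trans (by nlinarith) huy
        have ec : 0 ≤ c y * u y := mul_nonneg (hc y) hu0
        have eu : μ * (h * (1 - 1 / 50)) ≤ μ * u y := mul_le_mul_of_nonneg_left huy hμ.le
        have eh : 0 < μ * h := by positivity
        rw [eP, hf y]
        linarith
    _ ≤ ∫⁻ y in V, ENNReal.ofReal ((max (f y) 0 / δ) ^ d) := lintegral_mono_set hAV


lemma abp_max {d : ℕ} {Q : Set (EuclideanSpace ℝ (Fin d))}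
    {u : EuclideanSpace ℝ (Fin d) → ℝ} (hcont : ContinuousOn u (closure Q))
    (hbd : ∀ x ∈ frontier Q, u x ≤ 0)
    (hlim : ¬ Bornology.IsBounded Q →
          ∀ ε : ℝ, 0 < ε → ∃ R : ℝ, ∀ x ∈ Q, R ≤ ‖x‖ → u x ≤ ε)
    (hQ : IsOpen Q) {r : ℝ} (hr : 0 < r) {x₀ : EuclideanSpace ℝ (Fin d)} (hx₀ : x₀ ∈ Q)
    (h0 : 0 < u x₀) :
    ∃ x₁ ∈ Q, u x₀ * (1 + ‖x₁ - x₀‖ / (50 * r)) ^ 2 ≤ u x₁ ∧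
      ∀ x ∈ closure Q, u x ≤ u x₁ * (1 + ‖x - x₁‖ / (50 * r)) ^ 2 := by
  obtain ⟨R, hR⟩ : ∃ R : ℝ, ∀ x ∈ closure Q, R ≤ ‖x‖ → u x ≤ u x₀ := by
    by_cases hB : Bornology.IsBounded Q
    · obtain ⟨R, hR⟩ := hB.closure.exists_norm_le
      exact ⟨R + 1, fun x hx hxR => by have := hR x hx; linarith⟩
    · obtain ⟨R, hR⟩ := hlim hB (u x₀) h0
      refine ⟨R, fun x hx hxR => ?_⟩
      by_cases hxQ : x ∈ Q
      · exact hR x hxQ hxR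
      · have : x ∈ frontier Q := by rw [hQ.frontier_eq]; exact ⟨hx, hxQ⟩
        exact (hbd x this).trans h0.le
  set T := closure Q ∩ Metric.closedBall 0 (max R ‖x₀‖) with hT
  have hTc : IsCompact T := (isCompact_closedBall _ _).inter_left isClosed_closure
  have hx₀T : x₀ ∈ T := ⟨subset_closure hx₀, by simp⟩
  have hpos : ∀ x y : EuclideanSpace ℝ (Fin d), 0 < (1 + ‖x - y‖ / (50 * r)) ^ 2 :=
    fun x y => by positivity
  have hgc : ContinuousOn (fun x => u x / (1 + ‖x - x₀‖ / (50 * r)) ^ 2) T := by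
    refine (hcont.mono inter_subset_left).div (Continuous.continuousOn (by fun_prop)) ?_
    intro x _; exact (hpos x x₀).ne'
  obtain ⟨x₁, hx₁T, hmax⟩ := hTc.exists_isMaxOn ⟨x₀, hx₀T⟩ hgc
  have hm0 : u x₀ ≤ u x₁ / (1 + ‖x₁ - x₀‖ / (50 * r)) ^ 2 := by
    have := hmax hx₀T
    simpa using this
  have hA : u x₀ * (1 + ‖x₁ - x₀‖ / (50 * r)) ^ 2 ≤ u x₁ := (le_div_iff₀ (hpos _ _)).1 hm0
  have hu1 : 0 < u x₁ := lt_of_lt_of_le (mul_pos h0 (hpos _ _)) hA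
  have hx₁Q : x₁ ∈ Q := by
    by_contra hn
    have : x₁ ∈ frontier Q := by rw [hQ.frontier_eq]; exact ⟨hx₁T.1, hn⟩
    linarith [hbd x₁ this]
  refine ⟨x₁, hx₁Q, hA, fun x hx => ?_⟩
  have hg : u x / (1 + ‖x - x₀‖ / (50 * r)) ^ 2 ≤ u x₁ / (1 + ‖x₁ - x₀‖ / (50 * r)) ^ 2 := by
    by_cases hxT : ‖x‖ ≤ max R ‖x₀‖
    · exact hmax ⟨hx, by simpa using hxT⟩
    · push Not at hxT
      have h := hR x hx ((le_max_left _ _).trans hxT.le)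
      refine le_trans ?_ hm0
      rw [div_le_iff₀ (hpos _ _)]
      have h1 : 1 ≤ (1 + ‖x - x₀‖ / (50 * r)) ^ 2 :=
        one_le_pow₀ (by have : 0 ≤ ‖x - x₀‖ / (50 * r) := by positivity
                        linarith)
      nlinarith
  rw [div_le_div_iff₀ (hpos _ _) (hpos _ _)] at hg
  have htri : (1 + ‖x - x₀‖ / (50 * r)) ≤ (1 + ‖x₁ - x₀‖ / (50 * r)) * (1 + ‖x - x₁‖ / (50 * r)) := by
    have h1 : ‖x - x₀‖ / (50 * r) ≤ ‖x₁ - x₀‖ / (50 * r) + ‖x - x₁‖ / (50 * r) := by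
      rw [← add_div]; gcongr
      have := norm_add_le (x - x₁) (x₁ - x₀)
      rw [sub_add_sub_cancel] at this; linarith
    have h2 : 0 ≤ ‖x₁ - x₀‖ / (50 * r) * (‖x - x₁‖ / (50 * r)) := by positivity
    nlinarith
  have htri2 := pow_le_pow_left₀ (by positivity) htri 2
  rw [mul_pow] at htri2
  have := hpos x₁ x₀
  refine le_of_mul_le_mul_right (a := (1 + ‖x₁ - x₀‖ / (50 * r)) ^ 2) ?_ this
  calc _ ≤ _ := hg
    _ ≤ u x₁ * _ := mul_le_mul_of_nonneg_left htri2 hu1.le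
    _ = _ := by ring

lemma abp_schur {E : Type*} [NormedAddCommGroup E] [MeasurableSpace E] [BorelSpace E]
    [SecondCountableTopology E] {ν : Measure E} [SFinite ν] [ν.IsAddHaarMeasure] [ν.IsNegInvariant]
    {Q : Set E} (hQ : MeasurableSet Q) {k U F : E → ℝ≥0∞}
    (hk : Measurable k) (hF : Measurable F) (A : ℝ≥0∞) {q : ℝ} (hq : 1 ≤ q)
    (h : ∀ x ∈ Q, U x ≤ A * ∫⁻ y in Q, k (y - x) * F y ∂ν) :
    ∫⁻ x in Q, U x ^ q ∂ν ≤ (A * ∫⁻ z, k z ∂ν) ^ q * ∫⁻ y in Q, F y ^ q ∂ν := by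
  set J := ∫⁻ z, k z ∂ν with hJ
  have hq0 : 0 < q := by linarith
  have hq1 : 0 ≤ 1 - 1 / q := by
    have : 1 / q ≤ 1 := by rw [div_le_one hq0]; exact hq
    linarith
  have hkx : ∀ x, ∫⁻ y in Q, k (y - x) ∂ν ≤ J := fun x =>
    (setLIntegral_le_lintegral _ _).trans (lintegral_sub_right_eq_self k x).le
  have hpt : ∀ x ∈ Q, U x ^ q ≤ A ^ q * J ^ (q - 1) * ∫⁻ y in Q, k (y - x) * F y ^ q ∂ν := by
    intro x hx
    have hh : ∫⁻ y in Q, k (y - x) * F y ∂ν ≤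
        (∫⁻ y in Q, k (y - x) * F y ^ q ∂ν) ^ (1 / q) * J ^ (1 - 1 / q) := by
      have := ENNReal.lintegral_mul_norm_pow_le (μ := ν.restrict Q)
        (f := fun y => k (y - x) * F y ^ q) (g := fun y => k (y - x))
        (by fun_prop) (by fun_prop) (p := 1 / q) (q := 1 - 1 / q) (by positivity) hq1 (by ring)
      calc _ = ∫⁻ y in Q, (k (y - x) * F y ^ q) ^ (1 / q) * (k (y - x)) ^ (1 - 1 / q) ∂ν := by
            congr 1; ext y
            rw [ENNReal.mul_rpow_of_nonneg _ _ (by positivity), ← ENNReal.rpow_mul,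
              mul_one_div_cancel hq0.ne', ENNReal.rpow_one, mul_right_comm,
              ← ENNReal.rpow_add_of_nonneg _ _ (by positivity) hq1]
            simp
        _ ≤ _ := this
        _ ≤ _ := by gcongr; exact hkx x
    calc U x ^ q ≤ (A * ((∫⁻ y in Q, k (y - x) * F y ^ q ∂ν) ^ (1 / q) * J ^ (1 - 1 / q))) ^ q := by
          gcongr; exact (h x hx).trans (by gcongr)
      _ = _ := by
          rw [ENNReal.mul_rpow_of_nonneg _ _ hq0.le, ENNReal.mul_rpow_of_nonneg _ _ hq0.le,
            ← ENNReal.rpow_mul, ← ENNReal.rpow_mul, one_div_mul_cancel hq0.ne', ENNReal.rpow_one,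
            show (1 - 1 / q) * q = q - 1 by field_simp]
          ring
  calc ∫⁻ x in Q, U x ^ q ∂ν
      ≤ ∫⁻ x in Q, A ^ q * J ^ (q - 1) * ∫⁻ y in Q, k (y - x) * F y ^ q ∂ν ∂ν :=
        setLIntegral_mono' hQ hpt
    _ = A ^ q * J ^ (q - 1) * ∫⁻ x in Q, ∫⁻ y in Q, k (y - x) * F y ^ q ∂ν ∂ν := by
        rw [lintegral_const_mul]
        apply Measurable.lintegral_prod_right' (f := fun z : E × E => k (z.2 - z.1) * F z.2 ^ q)
        fun_prop
    _ = A ^ q * J ^ (q - 1) * ∫⁻ y in Q, ∫⁻ x in Q, k (y - x) * F y ^ q ∂ν ∂ν := by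
        rw [lintegral_lintegral_swap]
        apply Measurable.aemeasurable
        change Measurable (fun z : E × E => k (z.2 - z.1) * F z.2 ^ q)
        fun_prop
    _ ≤ A ^ q * J ^ (q - 1) * ∫⁻ y in Q, J * F y ^ q ∂ν := by
        gcongr with y
        rw [lintegral_mul_const _ (by fun_prop)]
        gcongr
        exact (setLIntegral_le_lintegral _ _).trans (lintegral_sub_left_eq_self k y).le
    _ = _ := by
        rw [lintegral_const_mul _ (by fun_prop), ENNReal.mul_rpow_of_nonneg _ _ hq0.le]
        have : J ^ q = J ^ (q - 1) * J := by
          conv_rhs => rw [← ENNReal.rpow_one J, ← ENNReal.rpow_mul, one_mul]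
          rw [← ENNReal.rpow_add_of_nonneg _ _ (by linarith) (by norm_num)]
          simp
        rw [this]; ring

lemma abp_scale {d : ℕ} {s : ℝ} (hs : 0 < s) (g : EuclideanSpace ℝ (Fin d) → ℝ≥0∞)
    (hg : Measurable g) :
    ∫⁻ x, g (s⁻¹ • x) = ENNReal.ofReal s ^ d * ∫⁻ x, g x := by
  have := Measure.map_addHaar_smul (volume : Measure (EuclideanSpace ℝ (Fin d)))
    (inv_ne_zero hs.ne')
  rw [← lintegral_map hg (by fun_prop), this, lintegral_smul_measure]
  simp only [finrank_euclideanSpace, Fintype.card_fin, smul_eq_mul]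
  rw [inv_pow, inv_inv, abs_of_pos (by positivity), ENNReal.ofReal_pow hs.le]

lemma abp_kint {d : ℕ} (hd : 1 ≤ d) :
    ∫⁻ x : EuclideanSpace ℝ (Fin d), ENNReal.ofReal (((1 + ‖x‖) ^ 2)⁻¹) ^ d < ∞ := by
  have := finite_integral_one_add_norm (E := EuclideanSpace ℝ (Fin d)) (μ := volume)
    (r := ((2 * d : ℕ) : ℝ)) (by
      simp only [finrank_euclideanSpace, Fintype.card_fin]
      exact_mod_cast (by omega : d < 2 * d))
  refine lt_of_eq_of_lt ?_ this
  congr 1; ext x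
  rw [← ENNReal.ofReal_pow (by positivity), Real.rpow_neg (by positivity), Real.rpow_natCast,
    pow_mul, inv_pow]

lemma abp_pointwise {d : ℕ} {δ : ℝ} (hδ0 : 0 < δ) {r : ℝ} (hr : 0 < r)
    {Q : Set (EuclideanSpace ℝ (Fin d))} (hQ : IsOpen Q)
    {u f : EuclideanSpace ℝ (Fin d) → ℝ} {x₀ x₁ : EuclideanSpace ℝ (Fin d)}
    (h0 : 0 < u x₀) (hA : u x₀ * (1 + ‖x₁ - x₀‖ / (50 * r)) ^ 2 ≤ u x₁)
    (hcore : ENNReal.ofReal ((u x₁ / (50 * r)) ^ d) *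
        volume (Metric.ball (0 : EuclideanSpace ℝ (Fin d)) 1) ≤
      ∫⁻ y in Q ∩ Metric.ball x₁ r, ENNReal.ofReal ((max (f y) 0 / δ) ^ d)) :
    ENNReal.ofReal (max (u x₀) 0) ^ d ≤
      (ENNReal.ofReal (50 * r) ^ d * ENNReal.ofReal (4 / δ) ^ d *
        (volume (Metric.ball (0 : EuclideanSpace ℝ (Fin d)) 1))⁻¹) *
      ∫⁻ y in Q, ENNReal.ofReal (((1 + ‖(50 * r)⁻¹ • (y - x₀)‖) ^ 2)⁻¹) ^ d *
        ENNReal.ofReal (max (f y) 0) ^ d := by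
  set V := volume (Metric.ball (0 : EuclideanSpace ℝ (Fin d)) 1) with hV
  have hV0 : V ≠ 0 := (Metric.measure_ball_pos _ _ one_pos).ne'
  have hVt : V ≠ ∞ := measure_ball_lt_top.ne
  set w := (1 + ‖x₁ - x₀‖ / (50 * r)) ^ 2 with hw
  have hw0 : 0 < w := by positivity
  have hu : u x₀ = 50 * r * (u x₀ * w / (50 * r) * w⁻¹) := by field_simp
  have key : ENNReal.ofReal (u x₀ * w / (50 * r) * w⁻¹) ^ d * V ≤
      ∫⁻ y in Q, ENNReal.ofReal (4 / δ) ^ d *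
        (ENNReal.ofReal (((1 + ‖(50 * r)⁻¹ • (y - x₀)‖) ^ 2)⁻¹) ^ d *
        ENNReal.ofReal (max (f y) 0) ^ d) := by
    calc ENNReal.ofReal (u x₀ * w / (50 * r) * w⁻¹) ^ d * V
        ≤ ENNReal.ofReal (u x₁ / (50 * r) * w⁻¹) ^ d * V := by gcongr
      _ = ENNReal.ofReal w⁻¹ ^ d * (ENNReal.ofReal ((u x₁ / (50 * r)) ^ d) * V) := by
          have h1 : 0 ≤ u x₁ / (50 * r) := by
            have : 0 ≤ u x₁ := le_trans (by positivity) hA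
            positivity
          rw [ENNReal.ofReal_mul h1, ENNReal.ofReal_pow h1, mul_pow]; ring
      _ ≤ ENNReal.ofReal w⁻¹ ^ d *
          ∫⁻ y in Q ∩ Metric.ball x₁ r, ENNReal.ofReal ((max (f y) 0 / δ) ^ d) := by gcongr
      _ = ∫⁻ y in Q ∩ Metric.ball x₁ r,
            ENNReal.ofReal w⁻¹ ^ d * ENNReal.ofReal ((max (f y) 0 / δ) ^ d) := by
          rw [lintegral_const_mul' _ _ (by finiteness)]
      _ ≤ ∫⁻ y in Q ∩ Metric.ball x₁ r, ENNReal.ofReal (4 / δ) ^ d *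
          (ENNReal.ofReal (((1 + ‖(50 * r)⁻¹ • (y - x₀)‖) ^ 2)⁻¹) ^ d *
          ENNReal.ofReal (max (f y) 0) ^ d) := by
          refine setLIntegral_mono' (hQ.inter Metric.isOpen_ball).measurableSet ?_
          intro y hy
          have hy2 : ‖y - x₁‖ < r := by simpa [dist_eq_norm] using hy.2
          have hm : 0 ≤ max (f y) 0 := le_max_right _ _
          rw [ENNReal.ofReal_pow (by positivity), ← mul_pow, ← mul_pow, ← mul_pow,
            ← ENNReal.ofReal_mul (by positivity), ← ENNReal.ofReal_mul (by positivity),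
            ← ENNReal.ofReal_mul (by positivity)]
          refine pow_le_pow_left' (ENNReal.ofReal_le_ofReal ?_) d
          have hn : ‖(50 * r)⁻¹ • (y - x₀)‖ = ‖y - x₀‖ / (50 * r) := by
            rw [norm_smul, Real.norm_of_nonneg (by positivity)]; field_simp
          rw [hn]
          have htri : 1 + ‖y - x₀‖ / (50 * r) ≤ 2 * (1 + ‖x₁ - x₀‖ / (50 * r)) := by
            have h1 : ‖y - x₀‖ / (50 * r) ≤ ‖x₁ - x₀‖ / (50 * r) + r / (50 * r) := by
              rw [← add_div]; gcongr
              have := norm_add_le (y - x₁) (x₁ - x₀)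
              rw [sub_add_sub_cancel] at this; linarith
            have h2 : r / (50 * r) = 1 / 50 := by field_simp
            have h3 : 0 ≤ ‖x₁ - x₀‖ / (50 * r) := by positivity
            linarith
          have h4 : (1 + ‖y - x₀‖ / (50 * r)) ^ 2 ≤ 4 * w := by
            have := pow_le_pow_left₀ (by positivity) htri 2
            rw [mul_pow] at this; rw [hw]; linarith
          have h5 : w⁻¹ ≤ 4 * ((1 + ‖y - x₀‖ / (50 * r)) ^ 2)⁻¹ := by
            rw [← div_eq_mul_inv, le_div_iff₀ (by positivity), inv_mul_le_iff₀ hw0]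
            linarith
          calc w⁻¹ * (max (f y) 0 / δ) ≤ (4 * ((1 + ‖y - x₀‖ / (50 * r)) ^ 2)⁻¹) *
                (max (f y) 0 / δ) := by gcongr
            _ = _ := by ring
      _ ≤ _ := lintegral_mono_set inter_subset_left
  rw [lintegral_const_mul' _ _ (by finiteness)] at key
  rw [max_eq_left h0.le]
  conv_lhs => rw [hu, ENNReal.ofReal_mul (by positivity), mul_pow]
  have key2 := (ENNReal.le_div_iff_mul_le (Or.inl hV0) (Or.inl hVt)).2 key
  rw [mul_assoc, mul_assoc]
  gcongr
  refine key2.trans (le_of_eq ?_)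
  rw [ENNReal.div_eq_inv_mul]
  ring

lemma abp_Lp {d : ℕ} (hd : 1 ≤ d) {δ : ℝ} :
    ∃ N : ℝ, 0 < N ∧ ∀ (p r : ℝ), (d : ℝ) ≤ p → 0 < r →
    ∀ (Q : Set (EuclideanSpace ℝ (Fin d))) (u f : EuclideanSpace ℝ (Fin d) → ℝ),
    IsOpen Q → Measurable f →
    (∀ x₀ ∈ Q, ENNReal.ofReal (max (u x₀) 0) ^ d ≤
      (ENNReal.ofReal (50 * r) ^ d * ENNReal.ofReal (4 / δ) ^ d *
        (volume (Metric.ball (0 : EuclideanSpace ℝ (Fin d)) 1))⁻¹) *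
      ∫⁻ y in Q, ENNReal.ofReal (((1 + ‖(50 * r)⁻¹ • (y - x₀)‖) ^ 2)⁻¹) ^ d *
        ENNReal.ofReal (max (f y) 0) ^ d) →
    eLpNorm (fun x => max (u x) 0) (ENNReal.ofReal p) (volume.restrict Q) ≤
      ENNReal.ofReal (N * r ^ 2) *
      eLpNorm (fun x => max (f x) 0) (ENNReal.ofReal p) (volume.restrict Q) := by
  set V := volume (Metric.ball (0 : EuclideanSpace ℝ (Fin d)) 1) with hV
  have hV0 : V ≠ 0 := (Metric.measure_ball_pos _ _ one_pos).ne'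
  have hVi : V⁻¹ ≠ ∞ := ENNReal.inv_ne_top.2 hV0
  set I := ∫⁻ x : EuclideanSpace ℝ (Fin d), ENNReal.ofReal (((1 + ‖x‖) ^ 2)⁻¹) ^ d with hI
  have hIt : I ≠ ∞ := (abp_kint hd).ne
  set B := ENNReal.ofReal (4 / δ) ^ d * V⁻¹ * I with hB
  have hBt : B ≠ ∞ := by
    rw [hB]; exact ENNReal.mul_ne_top (ENNReal.mul_ne_top (by finiteness) hVi) hIt
  have hd0 : (0 : ℝ) < d := by exact_mod_cast hd
  set B' := B ^ (1 / (d : ℝ)) with hB'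
  have hB't : B' ≠ ∞ := ENNReal.rpow_ne_top_of_nonneg (by positivity) hBt
  refine ⟨2500 * B'.toReal + 1, by positivity, ?_⟩
  intro p r hp hr Q u f hQ hf hpt
  have hp0 : 0 < p := by linarith
  have hq : 1 ≤ p / d := by rw [le_div_iff₀ hd0]; linarith
  have hS := abp_schur (ν := volume) hQ.measurableSet
    (k := fun z : EuclideanSpace ℝ (Fin d) =>
      ENNReal.ofReal (((1 + ‖(50 * r)⁻¹ • z‖) ^ 2)⁻¹) ^ d)
    (U := fun x => ENNReal.ofReal (max (u x) 0) ^ d)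
    (F := fun x => ENNReal.ofReal (max (f x) 0) ^ d)
    (by fun_prop) (by fun_prop) _ hq hpt
  rw [abp_scale (by positivity : 0 < 50 * r)
    (fun z : EuclideanSpace ℝ (Fin d) => ENNReal.ofReal (((1 + ‖z‖) ^ 2)⁻¹) ^ d)
    (by fun_prop), ← hI] at hS
  have hpow : ∀ t : ℝ≥0∞, (t ^ d) ^ (p / d) = t ^ p := by
    intro t
    rw [← ENNReal.rpow_natCast, ← ENNReal.rpow_mul]
    congr 1; field_simp
  simp only [hpow] at hS
  have hen : ∀ g : EuclideanSpace ℝ (Fin d) → ℝ,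
      eLpNorm (fun x => max (g x) 0) (ENNReal.ofReal p) (volume.restrict Q) =
        (∫⁻ x in Q, ENNReal.ofReal (max (g x) 0) ^ p) ^ (1 / p) := by
    intro g
    rw [eLpNorm_eq_lintegral_rpow_enorm_toReal (by simpa using hp0) (by finiteness),
      ENNReal.toReal_ofReal hp0.le]
    congr 2; ext x
    rw [Real.enorm_of_nonneg (le_max_right _ _)]
  rw [hen, hen]
  have h1 := ENNReal.rpow_le_rpow hS (by positivity : 0 ≤ 1 / p)
  refine h1.trans ?_
  rw [ENNReal.mul_rpow_of_nonneg _ _ (by positivity)]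
  gcongr
  have hAJ : ENNReal.ofReal (50 * r) ^ d * ENNReal.ofReal (4 / δ) ^ d * V⁻¹ *
      (ENNReal.ofReal (50 * r) ^ d * I) = (ENNReal.ofReal (50 * r) ^ 2) ^ d * B := by
    rw [hB]; ring
  rw [hAJ, ← ENNReal.rpow_mul, show p / d * (1 / p) = 1 / (d : ℝ) by field_simp,
    ENNReal.mul_rpow_of_nonneg _ _ (by positivity), ← hB', ← ENNReal.rpow_natCast _ d,
    ← ENNReal.rpow_mul, mul_one_div_cancel hd0.ne', ENNReal.rpow_one,
    ← ENNReal.ofReal_pow (by positivity), ← ENNReal.ofReal_toReal hB't,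
    ← ENNReal.ofReal_mul (by positivity)]
  apply ENNReal.ofReal_le_ofReal
  rw [ENNReal.toReal_ofReal (by positivity)]
  nlinarith [sq_nonneg r]

/-- **Corollary 5.5.** Assume the drift `b` is bounded, `|b| ≤ M`. Then for any `p ≥ d`,
`μ > 0`, and `u ∈ Ŵ²_d(Q) ∩ C(Q̄)` with `u ≤ 0` on `∂Q` and `limsup_{|x|→∞} u ≤ 0` if `Q` is
unbounded: `μ ‖u₊‖_{L_p(Q)} ≤ N (K+1) ‖(μu - Lu)₊‖_{L_p(Q)}` if `μ ≥ (K+1)M²`, and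
`μ² ‖u₊‖_{L_p(Q)} ≤ N (K+1)² M² ‖(μu - Lu)₊‖_{L_p(Q)}` if `μ ≤ (K+1)M²`,
where `N = N(d,δ,p)`. -/
theorem elliptic_resolvent_estimate_bounded_drift
    (d : ℕ) (hd : 1 ≤ d) (δ : ℝ) (hδ0 : 0 < δ) :
    ∀ p : ℝ, (d : ℝ) ≤ p →
    ∃ N : ℝ, 0 < N ∧
    ∀ (K : ℝ), 0 ≤ K →
    ∀ (a : EuclideanSpace ℝ (Fin d) → Matrix (Fin d) (Fin d) ℝ)
      (b : EuclideanSpace ℝ (Fin d) → EuclideanSpace ℝ (Fin d))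
      (c : EuclideanSpace ℝ (Fin d) → ℝ) (M : ℝ),
      -- measurability of the coefficients
      (∀ i j, Measurable fun x => a x i j) →
      (∀ i, Measurable fun x => b x i) →
      Measurable c →
      -- Assumption 5.1 (i)
      (∀ x, (a x).IsSymm) →
      (∀ x (ξ : EuclideanSpace ℝ (Fin d)), δ * ‖ξ‖ ^ 2 ≤ ∑ i, ∑ j, a x i j * ξ i * ξ j) →
      (∀ x, Matrix.trace (a x) ≤ K) →
      -- `b` is bounded with `M = sup |b|`
      0 ≤ M →
      (∀ x, ‖b x‖ ≤ M) →
      (∀ x, 0 ≤ c x) →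
      (∃ C : ℝ, ∀ x, c x ≤ C) →
      -- the domain `Q`
      ∀ (Q : Set (EuclideanSpace ℝ (Fin d))), IsOpen Q →
      -- `u` and its derivatives
      ∀ (u : EuclideanSpace ℝ (Fin d) → ℝ)
        (du : EuclideanSpace ℝ (Fin d) → EuclideanSpace ℝ (Fin d))
        (d2u : EuclideanSpace ℝ (Fin d) → Matrix (Fin d) (Fin d) ℝ),
        Measurable u →
        (∀ i, Measurable fun x => du x i) →
        (∀ i j, Measurable fun x => d2u x i j) →
        (∀ x ∈ Q, ∀ i,
          HasDerivAt (fun s : ℝ => u (x + s • EuclideanSpace.single i (1 : ℝ))) (du x i) 0) →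
        (∀ x ∈ Q, ∀ i j,
          HasDerivAt (fun s : ℝ => du (x + s • EuclideanSpace.single j (1 : ℝ)) i) (d2u x i j) 0) →
        -- `u ∈ Ŵ²_d(Q)`
        (∀ G : Set (EuclideanSpace ℝ (Fin d)), IsOpen G → Bornology.IsBounded G → G ⊆ Q →
          IntegrableOn (fun x => |u x| ^ (d : ℝ) + ‖du x‖ ^ (d : ℝ) + frobNorm (d2u x) ^ (d : ℝ))
            G volume) →
        -- `u ∈ C(Q̄)` (bounded and continuous)
        ContinuousOn u (closure Q) →
        (∃ M : ℝ, ∀ x ∈ closure Q, |u x| ≤ M) →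
        -- `u ≤ 0` on `∂Q`
        (∀ x ∈ frontier Q, u x ≤ 0) →
        -- `limsup_{|x|→∞} u ≤ 0` in case `Q` is unbounded
        (¬ Bornology.IsBounded Q →
          ∀ ε : ℝ, 0 < ε → ∃ R : ℝ, ∀ x ∈ Q, R ≤ ‖x‖ → u x ≤ ε) →
        ∀ μ : ℝ, 0 < μ →
        (((K + 1) * M ^ 2 ≤ μ →
          ENNReal.ofReal μ *
              eLpNorm (fun x => max (u x) 0) (ENNReal.ofReal p) (volume.restrict Q)
            ≤ ENNReal.ofReal (N * (K + 1)) *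
              eLpNorm (fun x => max (μ * u x -
                ((∑ i, ∑ j, a x i j * d2u x i j) + (∑ i, b x i * du x i) - c x * u x)) 0)
              (ENNReal.ofReal p) (volume.restrict Q))
        ∧ (μ ≤ (K + 1) * M ^ 2 →
          ENNReal.ofReal (μ ^ 2) *
              eLpNorm (fun x => max (u x) 0) (ENNReal.ofReal p) (volume.restrict Q)
            ≤ ENNReal.ofReal (N * (K + 1) ^ 2 * M ^ 2) *
              eLpNorm (fun x => max (μ * u x -
                ((∑ i, ∑ j, a x i j * d2u x i j) + (∑ i, b x i * du x i) - c x * u x)) 0)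
              (ENNReal.ofReal p) (volume.restrict Q))) := by
  intro p hp
  obtain ⟨N, hN, hLp⟩ := abp_Lp hd (δ := δ)
  refine ⟨N, hN, ?_⟩
  intro K hK a b c M ham hbm hcm _ ha htr hM hb hc _ Q hQ u du d2u hum hdum hd2um h1 h2 hW hcont
    _ hbd hlim μ hμ
  set f : EuclideanSpace ℝ (Fin d) → ℝ := fun x => μ * u x -
      ((∑ i, ∑ j, a x i j * d2u x i j) + (∑ i, b x i * du x i) - c x * u x) with hf
  have hfm : Measurable f := by
    refine (hum.const_mul μ).sub (Measurable.sub (Measurable.add ?_ ?_) (hcm.mul hum))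
    · exact Finset.measurable_sum _ fun i _ => Finset.measurable_sum _ fun j _ =>
        (ham i j).mul (hd2um i j)
    · exact Finset.measurable_sum _ fun i _ => (hbm i).mul (hdum i)
  have hdr : (1 : ℝ) ≤ d := by exact_mod_cast hd
  have hpw : ∀ t : ℝ, 0 ≤ t → t ≤ 1 + t ^ (d : ℝ) := by
    intro t ht
    rcases le_total t 1 with h | h
    · have : 0 ≤ t ^ (d : ℝ) := by positivity
      linarith
    · have := Real.rpow_le_rpow_of_exponent_le h hdr
      rw [Real.rpow_one] at this; linarith
  have hfn : ∀ x, 0 ≤ frobNorm (d2u x) := fun x => Real.sqrt_nonneg _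
  have hsym : ∀ᵐ x, x ∈ Q → ∀ i j, d2u x i j = d2u x j i := by
    refine abp_symm hQ (abp_locInt hQ hum (fun x => ?_) hW)
      (fun i => abp_locInt hQ (hdum i) (fun x => ?_) hW)
      (fun i j => abp_locInt hQ (hd2um i j) (fun x => ?_) hW) h1 h2
    all_goals
      have e1 : 0 ≤ |u x| ^ (d : ℝ) := by positivity
      have e2 : 0 ≤ ‖du x‖ ^ (d : ℝ) := by positivity
      have e3 : 0 ≤ frobNorm (d2u x) ^ (d : ℝ) := Real.rpow_nonneg (hfn x) _
    · have := hpw |u x| (abs_nonneg _)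
      linarith
    · have h3 := hpw ‖du x‖ (norm_nonneg _)
      have h4 : |du x i| ≤ ‖du x‖ := by
        have := PiLp.norm_apply_le (du x) i
        rwa [Real.norm_eq_abs] at this
      linarith
    · have h3 := hpw (frobNorm (d2u x)) (hfn x)
      have h4 : |d2u x i j| ≤ frobNorm (d2u x) := by
        apply Real.abs_le_sqrt
        calc (d2u x i j) ^ 2 ≤ ∑ j, (d2u x i j) ^ 2 :=
              Finset.single_le_sum (f := fun j => (d2u x i j) ^ 2)
                (fun j _ => sq_nonneg _) (Finset.mem_univ j)
          _ ≤ _ := Finset.single_le_sum (f := fun i => ∑ j, (d2u x i j) ^ 2)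
                (fun i _ => Finset.sum_nonneg fun j _ => sq_nonneg _) (Finset.mem_univ i)
      linarith
  have main : ∀ r : ℝ, 0 < r → K ≤ μ * r ^ 2 → M ≤ μ * r →
      eLpNorm (fun x => max (u x) 0) (ENNReal.ofReal p) (volume.restrict Q) ≤
      ENNReal.ofReal (N * r ^ 2) *
      eLpNorm (fun x => max (f x) 0) (ENNReal.ofReal p) (volume.restrict Q) := by
    intro r hr hKr hMr
    refine hLp p r hp hr Q u f hQ hfm ?_
    intro x₀ hx₀
    rcases le_or_gt (u x₀) 0 with h0 | h0
    · rw [max_eq_right h0, ENNReal.ofReal_zero, zero_pow (by omega)]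
      exact zero_le
    · obtain ⟨x₁, hx₁, hA, hgr⟩ := abp_max hcont hbd hlim hQ hr hx₀ h0
      have hu1 : 0 < u x₁ := lt_of_lt_of_le (by positivity) hA
      exact abp_pointwise hδ0 hr hQ h0 hA
        (abp_core hd hδ0 hr hμ hu1 hM hKr hMr a b c f ha htr hb hc hQ u du d2u h1 h2 hsym
          hcont hbd (fun x => rfl) hx₁ rfl hgr)
  constructor
  · intro hcase
    have hr2 : Real.sqrt ((K + 1) / μ) ^ 2 = (K + 1) / μ := Real.sq_sqrt (by positivity)
    have hr : 0 < Real.sqrt ((K + 1) / μ) := Real.sqrt_pos.2 (by positivity)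
    have hmr : μ * ((K + 1) / μ) = K + 1 := by field_simp
    have hm := main (Real.sqrt ((K + 1) / μ)) hr (by rw [hr2, hmr]; linarith) (by
      refine abs_le_of_sq_le_sq' ?_ (by positivity) |>.2
      rw [mul_pow, hr2, sq μ, mul_assoc, hmr]
      nlinarith [sq_nonneg M, mul_nonneg hK (sq_nonneg M), mul_nonneg hK hμ.le])
    rw [hr2] at hm
    calc _ ≤ ENNReal.ofReal μ * (ENNReal.ofReal (N * ((K + 1) / μ)) * _) := by gcongr
      _ = _ := by
        rw [← mul_assoc, ← ENNReal.ofReal_mul hμ.le]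
        congr 2
        field_simp
  · intro hcase
    have hM0 : 0 < M := by
      rcases hM.eq_or_lt with h | h
      · rw [← h] at hcase; norm_num at hcase; linarith
      · exact h
    have hmr : μ * ((K + 1) * M / μ) = (K + 1) * M := by field_simp
    have hm := main ((K + 1) * M / μ) (by positivity) (by
      rw [sq, ← mul_assoc, hmr, mul_div_assoc', le_div_iff₀ hμ]
      nlinarith [mul_nonneg hK (sub_nonneg.2 hcase), mul_nonneg hK (sq_nonneg M)]) (by
      rw [hmr]; nlinarith)
    calc _ ≤ ENNReal.ofReal (μ ^ 2) * (ENNReal.ofReal (N * ((K + 1) * M / μ) ^ 2) * _) := by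
          gcongr
      _ = _ := by
        rw [← mul_assoc, ← ENNReal.ofReal_mul (by positivity)]
        congr 2
        field_simp
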